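/- arXiv:1503.07623 — 2 statements merged into one kernel-verified Lean document; each statement's English description precedes it below -/
import Mathlib

section
/- Let a, b, b' ∈ ℂ. Let U ⊆ ℂ² be open and let v : ℂ² → ℂ be holomorphic on U and satisfy Appell's system E₁(b', b, 0, a) in the variables (s,t) on U. Let Ω ⊆ ℂ² be open such that for every (x,y) ∈ Ω one has 1−x ∈ ℂ∖(−∞,0], 1−y ∈ ℂ∖(−∞,0], and (xy/((1−x)(1−y)), −y/(1−y)) ∈ U. Then z(x,y) := (1−x)^(−b) · (1−y)^(−b') · v( xy/((1−x)(1−y)), −y/(1−y) ) satisfies Appell's system E₂(a, b, b', a, a) in the variables (x,y) on Ω. (Second inclusion of Theorem 2.4.) -/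
noncomputable section

/-- Partial derivative in the first variable. -/
def pdx (f : ℂ → ℂ → ℂ) : ℂ → ℂ → ℂ := fun x y => deriv (fun s => f s y) x

/-- Partial derivative in the second variable. -/
def pdy (f : ℂ → ℂ → ℂ) : ℂ → ℂ → ℂ := fun x y => deriv (fun t => f x t) y

/-- Euler operator `D = x ∂/∂x`. -/
def Dx (f : ℂ → ℂ → ℂ) : ℂ → ℂ → ℂ := fun x y => x * pdx f x y

/-- Euler operator `D' = y ∂/∂y`. -/
def Dy (f : ℂ → ℂ → ℂ) : ℂ → ℂ → ℂ := fun x y => y * pdy f x y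

/-- The operator `P₂` of Appell's system `E₂(a,b,b',c,c')`:
`P₂ z = D(c−1+D)z − x(a+D+D')(b+D)z`. -/
def appellP2 (a b c : ℂ) (z : ℂ → ℂ → ℂ) : ℂ → ℂ → ℂ :=
  fun x y =>
    Dx (fun x y => (c - 1) * z x y + Dx z x y) x y
      - x * (a * (b * z x y + Dx z x y)
        + Dx (fun x y => b * z x y + Dx z x y) x y
        + Dy (fun x y => b * z x y + Dx z x y) x y)

/-- The operator `Q₂` of Appell's system `E₂(a,b,b',c,c')`:
`Q₂ z = D'(c'−1+D')z − y(a+D+D')(b'+D')z`. -/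
def appellQ2 (a b' c' : ℂ) (z : ℂ → ℂ → ℂ) : ℂ → ℂ → ℂ :=
  fun x y =>
    Dy (fun x y => (c' - 1) * z x y + Dy z x y) x y
      - y * (a * (b' * z x y + Dy z x y)
        + Dx (fun x y => b' * z x y + Dy z x y) x y
        + Dy (fun x y => b' * z x y + Dy z x y) x y)

/-- The operator `P₁` of Appell's system `E₁(a,b,b',c)`. -/
def appellP1 (a b b' c : ℂ) (z : ℂ → ℂ → ℂ) : ℂ → ℂ → ℂ :=
  fun x y =>
    x * (1 - x) * pdx (pdx z) x y + y * (1 - x) * pdx (pdy z) x y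
      + (c - (a + b + 1) * x) * pdx z x y - b * y * pdy z x y - a * b * z x y

/-- The operator `Q₁` of Appell's system `E₁(a,b,b',c)`. -/
def appellQ1 (a b b' c : ℂ) (z : ℂ → ℂ → ℂ) : ℂ → ℂ → ℂ :=
  fun x y =>
    y * (1 - y) * pdy (pdy z) x y + x * (1 - y) * pdx (pdy z) x y
      + (c - (a + b' + 1) * y) * pdy z x y - b' * x * pdx z x y - a * b' * z x y

/-- The operator `R₁` of Appell's system `E₁(a,b,b',c)`. -/
def appellR1 (a b b' c : ℂ) (z : ℂ → ℂ → ℂ) : ℂ → ℂ → ℂ :=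
  fun x y => (x - y) * pdx (pdy z) x y - b' * pdx z x y + b * pdy z x y

open Complex Metric MeasureTheory Filter Topology Set in
theorem aux_fderiv_bound {f : ℂ × ℂ → ℂ} {U : Set (ℂ × ℂ)} (hU : IsOpen U)
    (hf : DifferentiableOn ℂ f U) {q : ℂ × ℂ} {ε M : ℝ} (hε : 0 < ε)
    (hb : closedBall q ε ⊆ U) (hM0 : 0 ≤ M) (hM : ∀ p ∈ closedBall q ε, ‖f p‖ ≤ M) :
    ‖fderiv ℂ f q‖ ≤ M / ε := by
  refine ContinuousLinearMap.opNorm_le_bound _ (by positivity) fun u => ?_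
  rcases eq_or_ne u 0 with rfl | hu
  · simp
  have hu' : 0 < ‖u‖ := norm_pos_iff.2 hu
  have hin : ∀ τ : ℂ, ‖τ‖ ≤ ε / ‖u‖ → q + τ • u ∈ closedBall q ε := by
    intro τ hτ
    rw [mem_closedBall, dist_eq_norm, add_sub_cancel_left, norm_smul]
    rwa [le_div_iff₀ hu'] at hτ
  have hd : ∀ τ : ℂ, ‖τ‖ ≤ ε / ‖u‖ →
      HasDerivAt (fun τ : ℂ => f (q + τ • u)) (fderiv ℂ f (q + τ • u) u) τ := by
    intro τ hτ
    have h1 : HasFDerivAt f (fderiv ℂ f (q + τ • u)) (q + τ • u) :=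
      (hf.differentiableAt (hU.mem_nhds (hb (hin τ hτ)))).hasFDerivAt
    have h2 : HasDerivAt (fun τ : ℂ => q + τ • u) u τ := by
      simpa using ((hasDerivAt_id τ).smul_const u).const_add q
    exact h1.comp_hasDerivAt τ h2
  have hr : 0 < ε / ‖u‖ := by positivity
  have h0 := hd 0 (by simpa using hr.le)
  have key : ‖deriv (fun τ : ℂ => f (q + τ • u)) 0‖ ≤ M / (ε / ‖u‖) := by
    apply Complex.norm_deriv_le_of_forall_mem_sphere_norm_le hr
    · apply DifferentiableOn.diffContOnCl
      rw [closure_ball _ hr.ne']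
      intro τ hτ
      exact (hd τ (by simpa using hτ)).differentiableAt.differentiableWithinAt
    · intro τ hτ
      exact hM _ (hin τ (by simpa using (mem_sphere.1 hτ).le))
  rw [h0.deriv] at key
  simp only [zero_smul, add_zero] at key
  calc _ ≤ _ := key
    _ = _ := by field_simp

open Complex Metric MeasureTheory Filter Topology Set in
theorem aux_fderiv_diff {f : ℂ × ℂ → ℂ} {U : Set (ℂ × ℂ)} (hU : IsOpen U)
    (hf : DifferentiableOn ℂ f U) (w : ℂ × ℂ) (hw : ‖w‖ ≤ 1) :
    DifferentiableOn ℂ (fun p => fderiv ℂ f p w) U := by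
  intro p₀ hp₀
  refine DifferentiableAt.differentiableWithinAt ?_
  obtain ⟨δ, hδ, hδU⟩ := Metric.isOpen_iff.1 hU p₀ hp₀
  obtain ⟨ε, hε, hε3⟩ : ∃ ε : ℝ, 0 < ε ∧ 3 * ε < δ := ⟨δ / 4, by linarith, by linarith⟩
  have hKU : closedBall p₀ (3 * ε) ⊆ U := (closedBall_subset_ball hε3).trans hδU
  obtain ⟨M, hM⟩ := (isCompact_closedBall p₀ (3 * ε)).exists_bound_of_continuousOn
    (hf.continuousOn.mono hKU)
  have hM0 : 0 ≤ M := (norm_nonneg _).trans (hM p₀ (mem_closedBall_self (by positivity)))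
  have hbd : ∀ q ∈ closedBall p₀ (2 * ε), ‖fderiv ℂ f q‖ ≤ M / ε := by
    intro q hq
    have hs : closedBall q ε ⊆ closedBall p₀ (3 * ε) :=
      closedBall_subset_closedBall' (by have := mem_closedBall.1 hq; linarith)
    exact aux_fderiv_bound hU hf hε (hs.trans hKU) hM0 fun p hp => hM p (hs hp)
  have hin : ∀ p ∈ ball p₀ ε, ∀ τ : ℂ, ‖τ‖ ≤ ε → p + τ • w ∈ closedBall p₀ (2 * ε) := by
    intro p hp τ hτ
    have h1 : ‖τ • w‖ ≤ ε := by
      rw [norm_smul]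
      nlinarith [norm_nonneg τ, norm_nonneg w]
    have h2 : ‖p - p₀‖ < ε := by simpa [dist_eq_norm] using hp
    rw [mem_closedBall, dist_eq_norm]
    calc ‖p + τ • w - p₀‖ = ‖(p - p₀) + τ • w‖ := by congr 1; abel
      _ ≤ _ := norm_add_le _ _
      _ ≤ _ := by linarith
  have h2U : closedBall p₀ (2 * ε) ⊆ U :=
    (closedBall_subset_closedBall (by linarith)).trans hKU
  have hcm : ∀ θ : ℝ, ‖circleMap 0 ε θ‖ ≤ ε := fun θ => by
    simp [abs_of_pos hε]
  -- the kernel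
  set c : ℝ → ℂ := fun θ => (2 * Real.pi * I : ℂ)⁻¹ *
    (deriv (circleMap 0 ε) θ * ((circleMap 0 ε θ) ^ 2)⁻¹) with hc
  have hcc : Continuous c := by
    have h1 : Continuous fun θ => ((circleMap 0 ε θ) ^ 2)⁻¹ :=
      ((continuous_circleMap 0 ε).pow 2).inv₀ fun θ => by
        simpa using hε.ne'
    have h2 : Continuous fun θ => deriv (circleMap 0 ε) θ := by
      simp only [deriv_circleMap]
      exact (continuous_circleMap 0 ε).mul continuous_const
    exact continuous_const.mul (h2.mul h1)
  have hrep : ∀ p ∈ ball p₀ ε,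
      fderiv ℂ f p w = ∫ θ in (0:ℝ)..(2 * Real.pi), c θ * f (p + circleMap 0 ε θ • w) := by
    intro p hp
    set g : ℂ → ℂ := fun τ => f (p + τ • w) with hg
    have hVo : IsOpen ((fun τ : ℂ => p + τ • w) ⁻¹' U) := hU.preimage (by fun_prop)
    have hgd : DifferentiableOn ℂ g ((fun τ : ℂ => p + τ • w) ⁻¹' U) :=
      hf.comp (by fun_prop) (fun _ h => h)
    have hsub : closedBall (0:ℂ) ε ⊆ ((fun τ : ℂ => p + τ • w) ⁻¹' U) := fun τ hτ =>
      h2U (hin p hp τ (by simpa using hτ))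
    have h1 := Complex.cderiv_eq_deriv hVo hgd hε hsub
    have h2 : deriv g 0 = fderiv ℂ f p w := by
      have h3 : HasFDerivAt f (fderiv ℂ f p) (p + (0:ℂ) • w) := by
        have hpU : p ∈ U := by simpa using h2U (hin p hp 0 (by simpa using hε.le))
        simpa using (hf.differentiableAt (hU.mem_nhds hpU)).hasFDerivAt
      have h4 : HasDerivAt (fun τ : ℂ => p + τ • w) w 0 := by
        simpa using ((hasDerivAt_id (0:ℂ)).smul_const w).const_add p
      exact (h3.comp_hasDerivAt 0 h4).deriv
    rw [← h2, ← h1, Complex.cderiv, circleIntegral, smul_eq_mul,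
      ← intervalIntegral.integral_const_mul]
    refine intervalIntegral.integral_congr fun θ _ => ?_
    simp only [hc, hg, smul_eq_mul, sub_zero]
    ring
  have hdint : HasFDerivAt
      (fun p => ∫ θ in (0:ℝ)..(2 * Real.pi), c θ * f (p + circleMap 0 ε θ • w))
      (∫ θ in (0:ℝ)..(2 * Real.pi), c θ • fderiv ℂ f (p₀ + circleMap 0 ε θ • w)) p₀ := by
    have hcont : ∀ p ∈ ball p₀ ε, Continuous fun θ => c θ * f (p + circleMap 0 ε θ • w) := by
      intro p hp
      refine hcc.mul ?_
      refine hf.continuousOn.comp_continuous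
        (continuous_const.add ((continuous_circleMap 0 ε).smul continuous_const)) fun θ => ?_
      exact h2U (hin p hp _ (hcm θ))
    refine intervalIntegral.hasFDerivAt_integral_of_dominated_of_fderiv_le (𝕜 := ℂ)
      (F' := fun p θ => c θ • fderiv ℂ f (p + circleMap 0 ε θ • w))
      (bound := fun θ => ‖c θ‖ * (M / ε)) (ball_mem_nhds p₀ hε) ?_ ?_ ?_ ?_ ?_ ?_
    · filter_upwards [ball_mem_nhds p₀ hε] with p hp
      exact (hcont p hp).aestronglyMeasurable
    · exact (hcont p₀ (mem_ball_self hε)).intervalIntegrable _ _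
    · refine AEStronglyMeasurable.smul hcc.aestronglyMeasurable ?_
      refine (Measurable.comp (measurable_fderiv ℂ f) ?_).aestronglyMeasurable
      exact (continuous_const.add
        ((continuous_circleMap 0 ε).smul continuous_const)).measurable
    · refine Eventually.of_forall fun θ _ p hp => ?_
      rw [norm_smul]
      exact mul_le_mul_of_nonneg_left (hbd _ (hin p hp _ (hcm θ))) (norm_nonneg _)
    · exact (hcc.norm.mul continuous_const).intervalIntegrable _ _
    · refine Eventually.of_forall fun θ _ p hp => ?_
      have h3 : HasFDerivAt f (fderiv ℂ f (p + circleMap 0 ε θ • w)) (p + circleMap 0 ε θ • w) :=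
        (hf.differentiableAt (hU.mem_nhds (h2U (hin p hp _ (hcm θ))))).hasFDerivAt
      have h4 := h3.comp p ((hasFDerivAt_id (𝕜 := ℂ) p).add_const (circleMap 0 ε θ • w))
      exact h4.const_mul (c θ)
  refine (hdint.differentiableAt).congr_of_eventuallyEq ?_
  filter_upwards [ball_mem_nhds p₀ hε] with p hp using hrep p hp

theorem aux_chain {h : ℂ → ℂ → ℂ} {S T : ℂ → ℂ} {S' T' τ : ℂ}
    (hh : DifferentiableAt ℂ (fun p : ℂ × ℂ => h p.1 p.2) (S τ, T τ))
    (hS : HasDerivAt S S' τ) (hT : HasDerivAt T T' τ) :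
    HasDerivAt (fun τ => h (S τ) (T τ))
      (pdx h (S τ) (T τ) * S' + pdy h (S τ) (T τ) * T') τ := by
  have h1 := hh.hasFDerivAt
  set L := fderiv ℂ (fun p : ℂ × ℂ => h p.1 p.2) (S τ, T τ) with hL
  have hx : pdx h (S τ) (T τ) = L (1, 0) := by
    have q : HasDerivAt (fun s : ℂ => (s, T τ)) (1, 0) (S τ) :=
      (hasDerivAt_id (S τ)).prodMk (hasDerivAt_const (S τ) (T τ))
    exact (HasFDerivAt.comp_hasDerivAt (S τ) h1 q).deriv
  have hy : pdy h (S τ) (T τ) = L (0, 1) := by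
    have q : HasDerivAt (fun t : ℂ => (S τ, t)) (0, 1) (T τ) :=
      (hasDerivAt_const (T τ) (S τ)).prodMk (hasDerivAt_id (T τ))
    exact (HasFDerivAt.comp_hasDerivAt (T τ) h1 q).deriv
  have h2 : HasDerivAt (fun τ => h (S τ) (T τ)) (L (S', T')) τ := by
    have q : HasDerivAt (fun τ : ℂ => (S τ, T τ)) (S', T') τ := hS.prodMk hT
    exact HasFDerivAt.comp_hasDerivAt τ h1 q
  have h3 : L (S', T') = pdx h (S τ) (T τ) * S' + pdy h (S τ) (T τ) * T' := by
    have : ((S', T') : ℂ × ℂ) = S' • ((1, 0) : ℂ × ℂ) + T' • ((0, 1) : ℂ × ℂ) := by simp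
    rw [this, map_add, map_smul, map_smul, hx, hy, smul_eq_mul, smul_eq_mul]
    ring
  rwa [h3] at h2

theorem aux_pdx_eq {h : ℂ → ℂ → ℂ} {p : ℂ × ℂ}
    (hh : DifferentiableAt ℂ (fun p : ℂ × ℂ => h p.1 p.2) p) :
    pdx h p.1 p.2 = fderiv ℂ (fun p : ℂ × ℂ => h p.1 p.2) p (1, 0) := by
  have q : HasDerivAt (fun s : ℂ => (s, p.2)) (1, 0) p.1 :=
    (hasDerivAt_id p.1).prodMk (hasDerivAt_const p.1 p.2)
  exact (HasFDerivAt.comp_hasDerivAt p.1 hh.hasFDerivAt q).deriv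

theorem aux_pdy_eq {h : ℂ → ℂ → ℂ} {p : ℂ × ℂ}
    (hh : DifferentiableAt ℂ (fun p : ℂ × ℂ => h p.1 p.2) p) :
    pdy h p.1 p.2 = fderiv ℂ (fun p : ℂ × ℂ => h p.1 p.2) p (0, 1) := by
  have q : HasDerivAt (fun t : ℂ => (p.1, t)) (0, 1) p.2 :=
    (hasDerivAt_const p.2 p.1).prodMk (hasDerivAt_id p.2)
  exact (HasFDerivAt.comp_hasDerivAt p.2 hh.hasFDerivAt q).deriv

theorem aux_pdx_diff {h : ℂ → ℂ → ℂ} {U : Set (ℂ × ℂ)} (hU : IsOpen U)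
    (hh : DifferentiableOn ℂ (fun p : ℂ × ℂ => h p.1 p.2) U) :
    DifferentiableOn ℂ (fun p : ℂ × ℂ => pdx h p.1 p.2) U :=
  (aux_fderiv_diff hU hh (1, 0) (by simp [Prod.norm_def])).congr fun _ hp =>
    aux_pdx_eq (hh.differentiableAt (hU.mem_nhds hp))

theorem aux_pdy_diff {h : ℂ → ℂ → ℂ} {U : Set (ℂ × ℂ)} (hU : IsOpen U)
    (hh : DifferentiableOn ℂ (fun p : ℂ × ℂ => h p.1 p.2) U) :
    DifferentiableOn ℂ (fun p : ℂ × ℂ => pdy h p.1 p.2) U :=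
  (aux_fderiv_diff hU hh (0, 1) (by simp [Prod.norm_def])).congr fun _ hp =>
    aux_pdy_eq (hh.differentiableAt (hU.mem_nhds hp))

theorem aux_symm {h : ℂ → ℂ → ℂ} {U : Set (ℂ × ℂ)} (hU : IsOpen U)
    (hh : DifferentiableOn ℂ (fun p : ℂ × ℂ => h p.1 p.2) U) {p : ℂ × ℂ} (hp : p ∈ U) :
    pdy (pdx h) p.1 p.2 = pdx (pdy h) p.1 p.2 := by
  have hX := (aux_pdx_diff hU hh).differentiableAt (hU.mem_nhds hp)
  have hY := (aux_pdy_diff hU hh).differentiableAt (hU.mem_nhds hp)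
  have h1 : ∀ᶠ q in nhds p, HasFDerivAt (fun p : ℂ × ℂ => h p.1 p.2)
      (pdx h q.1 q.2 • ContinuousLinearMap.fst ℂ ℂ ℂ
        + pdy h q.1 q.2 • ContinuousLinearMap.snd ℂ ℂ ℂ) q := by
    filter_upwards [hU.mem_nhds hp] with q hq
    have hd := hh.differentiableAt (hU.mem_nhds hq)
    convert hd.hasFDerivAt using 1
    rw [aux_pdx_eq hd, aux_pdy_eq hd]
    ext <;> simp
  have h2 := (hX.hasFDerivAt.smul_const (ContinuousLinearMap.fst ℂ ℂ ℂ)).add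
    (hY.hasFDerivAt.smul_const (ContinuousLinearMap.snd ℂ ℂ ℂ))
  have h3 := second_derivative_symmetric_of_eventually h1 h2 (0, 1) (1, 0)
  rw [aux_pdy_eq hX, aux_pdx_eq hY]
  simpa using h3

/-- The transformed function. -/
def NN (b b' : ℂ) (h : ℂ → ℂ → ℂ) : ℂ → ℂ → ℂ :=
  fun x y => (1 - x) ^ (-b) * (1 - y) ^ (-b') *
          h (x * y / ((1 - x) * (1 - y))) (-y / (1 - y))

theorem aux_cpow {x b : ℂ} (hx : 1 - x ∈ Complex.slitPlane) :
    HasDerivAt (fun x : ℂ => (1 - x) ^ (-b)) ((1 - x) ^ (-b) * (b / (1 - x))) x := by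
  have h0 : (1 - x) ≠ 0 := Complex.slitPlane_ne_zero hx
  have h1 : HasDerivAt (fun x : ℂ => 1 - x) (-1) x := by
    simpa using (hasDerivAt_id x).const_sub 1
  convert h1.cpow_const (c := -b) hx using 1
  rw [Complex.cpow_sub _ _ h0, Complex.cpow_one]
  ring

theorem aux_NNx {b b' : ℂ} {h : ℂ → ℂ → ℂ} {x y : ℂ}
    (hx : 1 - x ∈ Complex.slitPlane) (hy : 1 - y ∈ Complex.slitPlane)
    (hh : DifferentiableAt ℂ (fun p : ℂ × ℂ => h p.1 p.2)
      (x * y / ((1 - x) * (1 - y)), -y / (1 - y))) :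
    HasDerivAt (fun x => NN b b' h x y)
      (b / (1 - x) * NN b b' h x y + y / ((1 - x) ^ 2 * (1 - y)) * NN b b' (pdx h) x y) x := by
  have hx0 : (1 - x) ≠ 0 := Complex.slitPlane_ne_zero hx
  have hy0 : (1 - y) ≠ 0 := Complex.slitPlane_ne_zero hy
  have hS : HasDerivAt (fun x => x * y / ((1 - x) * (1 - y))) (y / ((1 - x) ^ 2 * (1 - y))) x := by
    have h1 : HasDerivAt (fun x : ℂ => x * y) y x := by
      simpa using (hasDerivAt_id x).mul_const y
    have h2 : HasDerivAt (fun x : ℂ => (1 - x) * (1 - y)) (-(1 - y)) x := by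
      simpa using ((hasDerivAt_id x).const_sub 1).mul_const (1 - y)
    refine (h1.div h2 (mul_ne_zero hx0 hy0)).congr_deriv ?_
    field_simp
    ring
  have h3 := aux_chain (S := fun x => x * y / ((1 - x) * (1 - y)))
    (T := fun _ => -y / (1 - y)) hh hS (hasDerivAt_const x _)
  refine (((aux_cpow (b := b) hx).mul_const ((1 - y) ^ (-b'))).mul h3).congr_deriv ?_
  simp only [NN]
  ring

theorem aux_NNy {b b' : ℂ} {h : ℂ → ℂ → ℂ} {x y : ℂ}
    (hx : 1 - x ∈ Complex.slitPlane) (hy : 1 - y ∈ Complex.slitPlane)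
    (hh : DifferentiableAt ℂ (fun p : ℂ × ℂ => h p.1 p.2)
      (x * y / ((1 - x) * (1 - y)), -y / (1 - y))) :
    HasDerivAt (fun y => NN b b' h x y)
      (b' / (1 - y) * NN b b' h x y + x / ((1 - x) * (1 - y) ^ 2) * NN b b' (pdx h) x y
        - 1 / (1 - y) ^ 2 * NN b b' (pdy h) x y) y := by
  have hx0 : (1 - x) ≠ 0 := Complex.slitPlane_ne_zero hx
  have hy0 : (1 - y) ≠ 0 := Complex.slitPlane_ne_zero hy
  have hS : HasDerivAt (fun y => x * y / ((1 - x) * (1 - y))) (x / ((1 - x) * (1 - y) ^ 2)) y := by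
    have h1 : HasDerivAt (fun y : ℂ => x * y) x y := by
      simpa using (hasDerivAt_id y).const_mul x
    have h2 : HasDerivAt (fun y : ℂ => (1 - x) * (1 - y)) (-(1 - x)) y := by
      simpa using ((hasDerivAt_id y).const_sub 1).const_mul (1 - x)
    refine (h1.div h2 (mul_ne_zero hx0 hy0)).congr_deriv ?_
    field_simp
    ring
  have hT : HasDerivAt (fun y : ℂ => -y / (1 - y)) (-1 / (1 - y) ^ 2) y := by
    have h1 : HasDerivAt (fun y : ℂ => -y) (-1) y := (hasDerivAt_id y).neg
    have h2 : HasDerivAt (fun y : ℂ => 1 - y) (-1) y := by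
      simpa using (hasDerivAt_id y).const_sub 1
    refine (h1.div h2 hy0).congr_deriv ?_
    field_simp
    ring
  have h3 := aux_chain (S := fun y => x * y / ((1 - x) * (1 - y)))
    (T := fun y => -y / (1 - y)) hh hS hT
  refine (((aux_cpow (b := b') hy).const_mul ((1 - x) ^ (-b))).mul h3).congr_deriv ?_
  simp only [NN]
  ring

/-- Second inclusion of Theorem 2.4: if `v` solves Appell's system `E₁(b', b, 0, a)` on `U`, then
`z(x,y) = (1−x)^(−b) (1−y)^(−b') · v(xy/((1−x)(1−y)), −y/(1−y))` solves Appell's system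
`E₂(a, b, b', a, a)` on `Ω`. -/
theorem stmt3 (a b b' : ℂ) (U : Set (ℂ × ℂ)) (hU : IsOpen U)
    (v : ℂ → ℂ → ℂ)
    (hv : DifferentiableOn ℂ (fun p : ℂ × ℂ => v p.1 p.2) U)
    (hE1 : ∀ p ∈ U, appellP1 b' b 0 a v p.1 p.2 = 0 ∧
      appellQ1 b' b 0 a v p.1 p.2 = 0 ∧
      appellR1 b' b 0 a v p.1 p.2 = 0)
    (Ω : Set (ℂ × ℂ)) (hΩ : IsOpen Ω)
    (hmem : ∀ p ∈ Ω, (1 - p.1) ∈ Complex.slitPlane ∧ (1 - p.2) ∈ Complex.slitPlane ∧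
      (p.1 * p.2 / ((1 - p.1) * (1 - p.2)), -p.2 / (1 - p.2)) ∈ U) :
    ∀ p ∈ Ω,
      appellP2 a b a
        (fun x y => (1 - x) ^ (-b) * (1 - y) ^ (-b') *
          v (x * y / ((1 - x) * (1 - y))) (-y / (1 - y)))
        p.1 p.2 = 0 ∧
      appellQ2 a b' a
        (fun x y => (1 - x) ^ (-b) * (1 - y) ^ (-b') *
          v (x * y / ((1 - x) * (1 - y))) (-y / (1 - y)))
        p.1 p.2 = 0 := by
  have hNN : (fun x y => (1 - x) ^ (-b) * (1 - y) ^ (-b') *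
          v (x * y / ((1 - x) * (1 - y))) (-y / (1 - y))) = NN b b' v := rfl
  rw [hNN]
  rintro ⟨x, y⟩ hp
  have hvx := aux_pdx_diff hU hv
  have hvy := aux_pdy_diff hU hv
  -- the two auxiliary functions
  set k : ℂ → ℂ → ℂ := fun s t => b * v s t + s * pdx v s t with hk
  set m : ℂ → ℂ → ℂ := fun s t => b' * v s t + s * pdx v s t + t * pdy v s t with hm
  have hkd : DifferentiableOn ℂ (fun p : ℂ × ℂ => k p.1 p.2) U :=
    (hv.const_mul b).add (differentiableOn_fst.mul hvx)
  have hmd : DifferentiableOn ℂ (fun p : ℂ × ℂ => m p.1 p.2) U :=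
    ((hv.const_mul b').add (differentiableOn_fst.mul hvx)).add (differentiableOn_snd.mul hvy)
  have slx : ∀ {h : ℂ → ℂ → ℂ}, DifferentiableOn ℂ (fun p : ℂ × ℂ => h p.1 p.2) U →
      ∀ q ∈ U, HasDerivAt (fun s => h s q.2) (pdx h q.1 q.2) q.1 := by
    intro h hh q hq
    have hd : DifferentiableAt ℂ (fun p : ℂ × ℂ => h p.1 p.2) (q.1, q.2) :=
      hh.differentiableAt (hU.mem_nhds hq)
    simpa using aux_chain (S := fun s => s) (T := fun _ => q.2) hd (hasDerivAt_id q.1)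
      (hasDerivAt_const q.1 q.2)
  have sly : ∀ {h : ℂ → ℂ → ℂ}, DifferentiableOn ℂ (fun p : ℂ × ℂ => h p.1 p.2) U →
      ∀ q ∈ U, HasDerivAt (fun t => h q.1 t) (pdy h q.1 q.2) q.2 := by
    intro h hh q hq
    have hd : DifferentiableAt ℂ (fun p : ℂ × ℂ => h p.1 p.2) (q.1, q.2) :=
      hh.differentiableAt (hU.mem_nhds hq)
    simpa using aux_chain (S := fun _ => q.1) (T := fun t => t) hd (hasDerivAt_const q.2 q.1)
      (hasDerivAt_id q.2)
  have hkx : ∀ q ∈ U, pdx k q.1 q.2 = (b + 1) * pdx v q.1 q.2 + q.1 * pdx (pdx v) q.1 q.2 := by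
    intro q hq
    refine (((slx hv q hq).const_mul b).add
      ((hasDerivAt_id q.1).mul (slx hvx q hq))).deriv.trans ?_
    simp only [id]
    ring
  have hky : ∀ q ∈ U, pdy k q.1 q.2 = b * pdy v q.1 q.2 + q.1 * pdx (pdy v) q.1 q.2 := by
    intro q hq
    rw [← aux_symm hU hv hq]
    exact (((sly hv q hq).const_mul b).add ((sly hvx q hq).const_mul q.1)).deriv
  have hmx : ∀ q ∈ U, pdx m q.1 q.2 = (b' + 1) * pdx v q.1 q.2 + q.1 * pdx (pdx v) q.1 q.2
      + q.2 * pdx (pdy v) q.1 q.2 := by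
    intro q hq
    refine ((((slx hv q hq).const_mul b').add
      ((hasDerivAt_id q.1).mul (slx hvx q hq))).add ((slx hvy q hq).const_mul q.2)).deriv.trans ?_
    simp only [id]
    ring
  have hmy : ∀ q ∈ U, pdy m q.1 q.2 = (b' + 1) * pdy v q.1 q.2 + q.1 * pdx (pdy v) q.1 q.2
      + q.2 * pdy (pdy v) q.1 q.2 := by
    intro q hq
    rw [← aux_symm hU hv hq]
    refine ((((sly hv q hq).const_mul b').add
      ((sly hvx q hq).const_mul q.1)).add ((hasDerivAt_id q.2).mul (sly hvy q hq))).deriv.trans ?_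
    simp only [id]
    ring
  -- first derivatives on `Ω`
  have hDx : ∀ q ∈ Ω, ∀ c : ℂ, c * NN b b' v q.1 q.2 + Dx (NN b b' v) q.1 q.2 =
      (c - b) * NN b b' v q.1 q.2 + (1 - q.1)⁻¹ * NN b b' k q.1 q.2 := by
    rintro ⟨x, y⟩ hq c
    obtain ⟨h1, h2, h3⟩ := hmem _ hq
    have hx0 : (1 - x) ≠ 0 := Complex.slitPlane_ne_zero h1
    have hy0 : (1 - y) ≠ 0 := Complex.slitPlane_ne_zero h2
    have := (aux_NNx (b := b) (b' := b') h1 h2 (hv.differentiableAt (hU.mem_nhds h3))).deriv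
    simp only [Dx, pdx] at this ⊢
    rw [this]
    simp only [NN, hk, pdx]
    field_simp
    ring
  have hDy : ∀ q ∈ Ω, ∀ c : ℂ, c * NN b b' v q.1 q.2 + Dy (NN b b' v) q.1 q.2 =
      (c - b') * NN b b' v q.1 q.2 + (1 - q.2)⁻¹ * NN b b' m q.1 q.2 := by
    rintro ⟨x, y⟩ hq c
    obtain ⟨h1, h2, h3⟩ := hmem _ hq
    have hx0 : (1 - x) ≠ 0 := Complex.slitPlane_ne_zero h1
    have hy0 : (1 - y) ≠ 0 := Complex.slitPlane_ne_zero h2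
    have := (aux_NNy (b := b) (b' := b') h1 h2 (hv.differentiableAt (hU.mem_nhds h3))).deriv
    simp only [Dy, pdy] at this ⊢
    rw [this]
    simp only [NN, hm, pdx, pdy]
    field_simp
    ring
  obtain ⟨h1, h2, h3⟩ := hmem _ hp
  simp only at h1 h2 h3
  have hx0 : (1 - x) ≠ 0 := Complex.slitPlane_ne_zero h1
  have hy0 : (1 - y) ≠ 0 := Complex.slitPlane_ne_zero h2
  have hevx : ∀ᶠ s in nhds x, (s, y) ∈ Ω :=
    (Continuous.prodMk_left y).continuousAt.eventually (hΩ.mem_nhds hp)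
  have hevy : ∀ᶠ t in nhds y, (x, t) ∈ Ω :=
    (Continuous.prodMk_right x).continuousAt.eventually (hΩ.mem_nhds hp)
  have dv := hv.differentiableAt (hU.mem_nhds h3)
  have dk := hkd.differentiableAt (hU.mem_nhds h3)
  have dm := hmd.differentiableAt (hU.mem_nhds h3)
  have hinvx : HasDerivAt (fun x : ℂ => (1 - x)⁻¹) ((1 - x) ^ 2)⁻¹ x := by
    exact (((hasDerivAt_id x).const_sub 1).inv hx0).congr_deriv (by simp)
  have hinvy : HasDerivAt (fun x : ℂ => (1 - x)⁻¹) ((1 - y) ^ 2)⁻¹ y := by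
    exact (((hasDerivAt_id y).const_sub 1).inv hy0).congr_deriv (by simp)
  have A1 : ∀ c : ℂ, pdx (fun x y => c * NN b b' v x y + Dx (NN b b' v) x y) x y = _ := fun c =>
    ((((aux_NNx (b := b) (b' := b') h1 h2 dv).const_mul (c - b)).add
      (hinvx.mul (aux_NNx (b := b) (b' := b') h1 h2 dk))).congr_of_eventuallyEq
        (hevx.mono fun s hs => hDx (s, y) hs c)).deriv
  have A2 : ∀ c : ℂ, pdy (fun x y => c * NN b b' v x y + Dx (NN b b' v) x y) x y = _ := fun c =>
    ((((aux_NNy (b := b) (b' := b') h1 h2 dv).const_mul (c - b)).add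
      ((aux_NNy (b := b) (b' := b') h1 h2 dk).const_mul ((1 - x)⁻¹))).congr_of_eventuallyEq
        (hevy.mono fun s hs => hDx (x, s) hs c)).deriv
  have A3 : ∀ c : ℂ, pdx (fun x y => c * NN b b' v x y + Dy (NN b b' v) x y) x y = _ := fun c =>
    ((((aux_NNx (b := b) (b' := b') h1 h2 dv).const_mul (c - b')).add
      ((aux_NNx (b := b) (b' := b') h1 h2 dm).const_mul ((1 - y)⁻¹))).congr_of_eventuallyEq
        (hevx.mono fun s hs => hDy (s, y) hs c)).deriv
  have A4 : ∀ c : ℂ, pdy (fun x y => c * NN b b' v x y + Dy (NN b b' v) x y) x y = _ := fun c =>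
    ((((aux_NNy (b := b) (b' := b') h1 h2 dv).const_mul (c - b')).add
      (hinvy.mul (aux_NNy (b := b) (b' := b') h1 h2 dm))).congr_of_eventuallyEq
        (hevy.mono fun s hs => hDy (x, s) hs c)).deriv
  have B1 := hDx (x, y) hp b
  have B2 := hDy (x, y) hp b'
  have E1 := hE1 _ h3
  have K1 := hkx _ h3
  have K2 := hky _ h3
  have K3 := hmx _ h3
  have K4 := hmy _ h3
  simp only [appellP1, appellQ1, appellR1] at E1 K1 K2 K3 K4
  obtain ⟨e1, e2, e3⟩ := E1
  simp only at B1 B2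
  constructor
  · simp only [appellP2]
    rw [B1]
    rw [show ∀ f : ℂ → ℂ → ℂ, Dx f x y = x * pdx f x y from fun _ => rfl,
      show ∀ f : ℂ → ℂ → ℂ, Dx f x y = x * pdx f x y from fun _ => rfl,
      show ∀ f : ℂ → ℂ → ℂ, Dy f x y = y * pdy f x y from fun _ => rfl]
    rw [A1, A1, A2]
    simp only [NN, K1, K2]
    simp only [hk]
    generalize pdx (pdx v) _ _ = vss at *
    generalize pdx (pdy v) _ _ = vst at *
    generalize pdy (pdy v) _ _ = vtt at *
    generalize pdx v _ _ = vs at *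
    generalize pdy v _ _ = vt at *
    generalize v _ _ = v0 at *
    generalize (1 - x) ^ (-b) = g1 at *
    generalize (1 - y) ^ (-b') = g2 at *
    linear_combination (norm := skip) g1 * g2 * (x * y / ((1 - x) * (1 - y)) * e1
      - x / (1 - x) * (-y / (1 - y)) * e3)
    field_simp
    ring
  · simp only [appellQ2]
    rw [B2]
    rw [show ∀ f : ℂ → ℂ → ℂ, Dx f x y = x * pdx f x y from fun _ => rfl,
      show ∀ f : ℂ → ℂ → ℂ, Dy f x y = y * pdy f x y from fun _ => rfl,
      show ∀ f : ℂ → ℂ → ℂ, Dy f x y = y * pdy f x y from fun _ => rfl]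
    rw [A4, A4, A3]
    simp only [NN, K3, K4]
    simp only [hm]
    generalize pdx (pdx v) _ _ = vss at *
    generalize pdx (pdy v) _ _ = vst at *
    generalize pdy (pdy v) _ _ = vtt at *
    generalize pdx v _ _ = vs at *
    generalize pdy v _ _ = vt at *
    generalize v _ _ = v0 at *
    generalize (1 - x) ^ (-b) = g1 at *
    generalize (1 - y) ^ (-b') = g2 at *
    linear_combination (norm := skip) g1 * g2 * (x * y / ((1 - x) * (1 - y)) * e1
      + (-y / (1 - y)) * e2)
    field_simp
    ring
end
end

section
/- Let a, b, c ∈ ℂ with Re(b−c) > −1. For (s,t) in D = {(s,t) ∈ ℝ² : 0 < s < 1 < t}, define u(s,t) = ∫₀^s σ^(b−c) (1−σ)^(c−a−1) (t−σ)^(−b) dσ, where for a positive real r and e ∈ ℂ, r^e = exp(e·log r). Then for all (s,t) ∈ D, t(1−t)·∂²u/∂t² + (c−(a+b+1)t)·∂u/∂t − ab·u = b·( s(1−s)/(t−s) )·∂u/∂s. (Intermediate identity in the proof of Lemma 2.2, obtained by integrating Lemma 2.1 in s; the boundary term at σ = 0 vanishes since Re(b−c) > −1.) -/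
noncomputable section

/-- The power `r^e = exp(e·log r)` of a positive real `r` with complex exponent `e`. -/
def cpowR (r : ℝ) (e : ℂ) : ℂ := Complex.exp (e * (Real.log r : ℂ))

/-- The indefinite integral `u(s,t) = ∫₀^s σ^(b−c) (1−σ)^(c−a−1) (t−σ)^(−b) dσ`. -/
def uInt (a b c : ℂ) (s t : ℝ) : ℂ :=
  ∫ σ in (0:ℝ)..s, cpowR σ (b - c) * cpowR (1 - σ) (c - a - 1) * cpowR (t - σ) (-b)


theorem cpowR_add_one' (r : ℝ) (hr : 0 < r) (e : ℂ) : cpowR r (e + 1) = cpowR r e * r := by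
  unfold cpowR
  rw [add_mul, Complex.exp_add, one_mul, ← Complex.ofReal_exp, Real.exp_log hr]

theorem cpowR_eq_cpow (r : ℝ) (hr : 0 < r) (e : ℂ) : cpowR r e = (r : ℂ) ^ e := by
  unfold cpowR
  rw [Complex.cpow_def_of_ne_zero (by exact_mod_cast hr.ne'), Complex.ofReal_log hr.le, mul_comm]

theorem cpowR_hasDerivAt (r : ℝ) (hr : 0 < r) (e : ℂ) :
    HasDerivAt (fun x : ℝ => cpowR x e) (e * cpowR r (e - 1)) r := by
  have h := (((Real.hasDerivAt_log hr.ne').ofReal_comp).const_mul e).cexp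
  have h2 := cpowR_add_one' r hr (e - 1)
  rw [sub_add_cancel] at h2
  have hr' : (r : ℂ) ≠ 0 := by exact_mod_cast hr.ne'
  refine h.congr_deriv ?_
  change cpowR r e * _ = _
  rw [h2]
  push_cast
  field_simp

theorem cpowR_continuousAt (r : ℝ) (hr : 0 < r) (e : ℂ) :
    ContinuousAt (fun x : ℝ => cpowR x e) r := (cpowR_hasDerivAt r hr e).continuousAt

theorem cpowR_contOn {X : Type*} [TopologicalSpace X] {f : X → ℝ} {S : Set X}
    (hf : ContinuousOn f S) (hp : ∀ x ∈ S, 0 < f x) (e : ℂ) :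
    ContinuousOn (fun x => cpowR (f x) e) S := fun x hx =>
  ContinuousAt.comp_continuousWithinAt (g := fun x : ℝ => cpowR x e)
    (cpowR_continuousAt _ (hp x hx) e) (hf x hx)

theorem w_integrable (p q : ℂ) (hp : -1 < p.re) (s : ℝ) (hs : 0 < s) (hs1 : s < 1) :
    IntervalIntegrable (fun σ : ℝ => cpowR σ p * cpowR (1 - σ) q) MeasureTheory.volume 0 s := by
  refine IntervalIntegrable.mul_continuousOn ?_ ?_
  · refine (intervalIntegral.intervalIntegrable_cpow' (a := 0) (b := s) hp).congr ?_
    intro x hx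
    rw [Set.uIoc_of_le hs.le] at hx
    exact (cpowR_eq_cpow x hx.1 p).symm
  · rw [Set.uIcc_of_le hs.le]
    refine cpowR_contOn (by fun_prop) ?_ q
    intro x hx
    linarith [hx.2]

theorem wt_integrable (w : ℝ → ℂ) (s : ℝ) (hs : 0 < s) (hs1 : s < 1)
    (hw : IntervalIntegrable w MeasureTheory.volume 0 s) (e : ℂ) (t : ℝ) (ht : 1 < t) :
    IntervalIntegrable (fun σ : ℝ => w σ * cpowR (t - σ) e) MeasureTheory.volume 0 s := by
  refine hw.mul_continuousOn ?_
  rw [Set.uIcc_of_le hs.le]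
  refine cpowR_contOn (by fun_prop) ?_ e
  intro x hx
  linarith [hx.2]

theorem K_hasDerivAt (w : ℝ → ℂ) (s : ℝ) (hs : 0 < s) (hs1 : s < 1)
    (hw : IntervalIntegrable w MeasureTheory.volume 0 s) (e : ℂ) (t : ℝ) (ht : 1 < t) :
    HasDerivAt (fun t : ℝ => ∫ σ in (0:ℝ)..s, w σ * cpowR (t - σ) e)
      (e * ∫ σ in (0:ℝ)..s, w σ * cpowR (t - σ) (e - 1)) t := by
  obtain ⟨t₁, h1, h2⟩ := exists_between ht
  have hcomp : IsCompact (Set.Icc t₁ (t + 1) ×ˢ Set.Icc 0 s) := isCompact_Icc.prod isCompact_Icc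
  obtain ⟨C, hC⟩ := hcomp.exists_bound_of_continuousOn
    (f := fun x : ℝ × ℝ => e * cpowR (x.1 - x.2) (e - 1))
    (continuousOn_const.mul (cpowR_contOn (by fun_prop)
      (by rintro ⟨x, y⟩ ⟨hx, hy⟩; simp only [Set.mem_Icc] at hx hy ⊢; linarith [hx.1, hy.2]) _))
  have key := intervalIntegral.hasDerivAt_integral_of_dominated_loc_of_deriv_le
    (μ := MeasureTheory.volume) (a := 0) (b := s) (x₀ := t) (s := Set.Icc t₁ (t + 1))
    (F := fun x σ => w σ * cpowR (x - σ) e)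
    (F' := fun x σ => w σ * (e * cpowR (x - σ) (e - 1)))
    (bound := fun σ => ‖w σ‖ * C)
    (Icc_mem_nhds h2 (by linarith)) ?_ (wt_integrable w s hs hs1 hw e t ht) ?_ ?_ ?_ ?_
  · refine key.2.congr_deriv ?_
    rw [← intervalIntegral.integral_const_mul]
    congr 1
    ext σ
    ring
  · filter_upwards [lt_mem_nhds ht] with x hx
    exact (intervalIntegrable_iff.mp (wt_integrable w s hs hs1 hw e x hx)).aestronglyMeasurable
  · have := (wt_integrable w s hs hs1 hw (e - 1) t ht).const_mul e
    refine (intervalIntegrable_iff.mp (this.congr ?_)).aestronglyMeasurable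
    intro x hx
    simp only
    ring
  · refine Filter.Eventually.of_forall ?_
    intro σ hσ x hx
    rw [Set.uIoc_of_le hs.le] at hσ
    rw [norm_mul]
    exact mul_le_mul_of_nonneg_left (hC (x, σ) ⟨hx, hσ.1.le, hσ.2⟩) (norm_nonneg _)
  · exact hw.norm.mul_const C
  · refine Filter.Eventually.of_forall ?_
    intro σ hσ x hx
    rw [Set.uIoc_of_le hs.le] at hσ
    have h := (cpowR_hasDerivAt (x - σ) (by linarith [hx.1, hσ.2]) e).comp_sub_const x σ
    exact h.const_mul (w σ)

theorem G_deriv (a b c : ℂ) (t x : ℝ) (hx : 0 < x) (hx1 : x < 1) (ht : 1 < t) :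
    HasDerivAt (fun σ : ℝ => b * ((σ : ℂ) ^ (b - c + 1) * cpowR (1 - σ) (c - a)
        * cpowR (t - σ) (-b - 1)))
      (cpowR x (b - c) * cpowR (1 - x) (c - a - 1) * cpowR (t - x) (-b - 1 - 1)
          * ((t : ℂ) * (1 - t) * (b * (b + 1)))
        + cpowR x (b - c) * cpowR (1 - x) (c - a - 1) * cpowR (t - x) (-b - 1)
          * ((c - (a + b + 1) * t) * (-b))
        - cpowR x (b - c) * cpowR (1 - x) (c - a - 1) * cpowR (t - x) (-b) * (a * b)) x := by
  have h1 := cpowR_hasDerivAt x hx (b - c + 1)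
  have h2 := (cpowR_hasDerivAt (1 - x) (by linarith) (c - a)).comp_const_sub 1 x
  have h3 := (cpowR_hasDerivAt (t - x) (by linarith) (-b - 1)).comp_const_sub t x
  have h := ((h1.mul h2).mul h3).const_mul b
  have e1 := cpowR_add_one' x hx (b - c)
  have e2 := cpowR_add_one' (1 - x) (by linarith) (c - a - 1)
  have e3 := cpowR_add_one' (t - x) (by linarith) (-b - 1 - 1)
  have e4 := cpowR_add_one' (t - x) (by linarith) (-b - 1)
  rw [sub_add_cancel] at e2 e3 e4
  refine (h.congr_of_eventuallyEq ?_).congr_deriv ?_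
  · filter_upwards [lt_mem_nhds hx] with y hy
    simp only [Pi.mul_apply]
    rw [cpowR_eq_cpow y hy]
  · simp only [Pi.mul_apply]
    rw [add_sub_cancel_right, e4, e3, e2, e1]
    push_cast
    ring

/-- Intermediate identity in the proof of Lemma 2.2:
`t(1−t)·u_tt + (c−(a+b+1)t)·u_t − ab·u = b·(s(1−s)/(t−s))·u_s` on `{0 < s < 1 < t}`,
provided `Re(b−c) > −1`. -/
theorem stmt10 (a b c : ℂ) (hbc : -1 < (b - c).re) :
    ∀ s t : ℝ, 0 < s → s < 1 → 1 < t →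
      (t : ℂ) * (1 - (t : ℂ)) *
          deriv (fun t' : ℝ => deriv (fun t'' : ℝ => uInt a b c s t'') t') t
        + (c - (a + b + 1) * (t : ℂ)) * deriv (fun t' : ℝ => uInt a b c s t') t
        - a * b * uInt a b c s t =
      b * ((s : ℂ) * (1 - (s : ℂ)) / ((t : ℂ) - (s : ℂ))) *
        deriv (fun s' : ℝ => uInt a b c s' t) s := by
  intro s t hs hs1 ht
  have hw := w_integrable (b - c) (c - a - 1) hbc s hs hs1
  have d1 : ∀ t' : ℝ, 1 < t' → HasDerivAt (fun t'' : ℝ => uInt a b c s t'') _ t' :=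
    fun t' ht' => K_hasDerivAt _ s hs hs1 hw (-b) t' ht'
  have d2 := (K_hasDerivAt _ s hs hs1 hw (-b - 1) t ht).const_mul (-b)
  have d2' : deriv (fun t' : ℝ => deriv (fun t'' : ℝ => uInt a b c s t'') t') t
      = -b * ((-b - 1) * ∫ σ in (0:ℝ)..s, cpowR σ (b - c) * cpowR (1 - σ) (c - a - 1)
        * cpowR (t - σ) (-b - 1 - 1)) := by
    refine Filter.EventuallyEq.deriv_eq ?_ |>.trans d2.deriv
    filter_upwards [lt_mem_nhds ht] with y hy
    exact (d1 y hy).deriv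
  have i0 := wt_integrable _ s hs hs1 hw (-b) t ht
  have i1 := wt_integrable _ s hs hs1 hw (-b - 1) t ht
  have i2 := wt_integrable _ s hs hs1 hw (-b - 1 - 1) t ht
  have d3 : HasDerivAt (fun s' : ℝ => uInt a b c s' t)
      (cpowR s (b - c) * cpowR (1 - s) (c - a - 1) * cpowR (t - s) (-b)) s := by
    have hco : ContinuousOn (fun σ : ℝ => cpowR σ (b - c) * cpowR (1 - σ) (c - a - 1)
        * cpowR (t - σ) (-b)) (Set.Ioo 0 1) := by
      refine ((cpowR_contOn (by fun_prop) ?_ _).mul (cpowR_contOn (by fun_prop) ?_ _)).mul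
        (cpowR_contOn (by fun_prop) ?_ _) <;> intro x hx <;> linarith [hx.1, hx.2]
    exact intervalIntegral.integral_hasDerivAt_right i0
      (hco.stronglyMeasurableAtFilter isOpen_Ioo s ⟨hs, hs1⟩)
      (hco.continuousAt (Ioo_mem_nhds hs hs1))
  have ftc := intervalIntegral.integral_eq_sub_of_hasDerivAt_of_le hs.le
    (f := fun σ : ℝ => b * ((σ : ℂ) ^ (b - c + 1) * cpowR (1 - σ) (c - a)
        * cpowR (t - σ) (-b - 1))) ?_
    (fun x hx => G_deriv a b c t x hx.1 (hx.2.trans hs1) ht)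
    (((i2.mul_const _).add (i1.mul_const _)).sub (i0.mul_const _))
  · rw [intervalIntegral.integral_sub ((i2.mul_const _).add (i1.mul_const _)) (i0.mul_const _),
      intervalIntegral.integral_add (i2.mul_const _) (i1.mul_const _),
      intervalIntegral.integral_mul_const, intervalIntegral.integral_mul_const,
      intervalIntegral.integral_mul_const] at ftc
    have hne : b - c + 1 ≠ 0 := by
      intro h
      have := congrArg Complex.re h
      simp at this hbc
      linarith
    simp only [Complex.ofReal_zero, Complex.zero_cpow hne, zero_mul, mul_zero, sub_zero] at ftc
    rw [d2', (d1 t ht).deriv, d3.deriv]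
    have e1 := cpowR_add_one' s hs (b - c)
    have e2 := cpowR_add_one' (1 - s) (by linarith) (c - a - 1)
    have e3 := cpowR_add_one' (t - s) (by linarith) (-b - 1)
    rw [sub_add_cancel] at e2 e3
    rw [← cpowR_eq_cpow s hs, e1, e2] at ftc
    rw [e3]
    have hts : (t : ℂ) - s ≠ 0 := by
      rw [← Complex.ofReal_sub]
      exact_mod_cast (by linarith : (0:ℝ) < t - s).ne'
    unfold uInt
    push_cast at ftc ⊢
    field_simp
    linear_combination ftc
  · have hre : 0 < (b - c + 1).re := by
      simp at hbc ⊢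
      linarith
    refine continuousOn_const.mul (((Complex.continuous_ofReal_cpow_const hre).continuousOn.mul
      (cpowR_contOn (by fun_prop) ?_ _)).mul (cpowR_contOn (by fun_prop) ?_ _)) <;>
      intro x hx <;> linarith [hx.1, hx.2]
end
end
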